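/- Fix a constant C > 0, and let t : ℕ → ℕ satisfy t(n)/√(log n) → ∞ and t(n) ≤ C·log n. Then there exist a constant c > 0 and N₀ such that for all n ≥ N₀ and all integers 1 ≤ r ≤ 0.99·n: Σ_{ℓ=1}^{r} C(r,ℓ) · Pr[w_1 ⊕ ⋯ ⊕ w_ℓ = 0] ≤ 2^{−c·t(n)²}, where w_1, …, w_ℓ are independent uniformly random elements of S_{t(n),n} and C(r,ℓ) denotes the binomial coefficient r choose ℓ. -/

import Mathlib

open Finset Filter
open scoped Classical

noncomputable def sg (a b : ZMod 2) : ℝ := if a = 1 ∧ b = 1 then -1 else 1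
noncomputable def chi {n : ℕ} (y v : Fin n → ZMod 2) : ℝ := ∏ i, sg (y i) (v i)
noncomputable def SS (n j : ℕ) : Finset (Fin n → ZMod 2) :=
  univ.filter (fun v : Fin n → ZMod 2 => hammingNorm v = j)
noncomputable def EE {n : ℕ} (y : Fin n → ZMod 2) (j : ℕ) : ℝ := ∑ v ∈ SS n j, chi y v

lemma zmod2_cases (a : ZMod 2) : a = 0 ∨ a = 1 := by
  revert a; decide

lemma univ_zmod2 : (univ : Finset (ZMod 2)) = {0, 1} := by
  ext a; simpa using zmod2_cases a

lemma sg_zero_right (a : ZMod 2) : sg a 0 = 1 := by simp [sg]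
lemma sg_zero_left (a : ZMod 2) : sg 0 a = 1 := by simp [sg]
lemma sg_one_one : sg 1 1 = -1 := by simp [sg]
lemma sg_add (a b c : ZMod 2) : sg a (b + c) = sg a b * sg a c := by
  have h11 : (1 : ZMod 2) + 1 = 0 := by decide
  rcases zmod2_cases a with rfl | rfl <;> rcases zmod2_cases b with rfl | rfl <;>
    rcases zmod2_cases c with rfl | rfl <;> simp [sg, h11]
lemma sg_sq (a b : ZMod 2) : sg a b * sg a b = 1 := by
  unfold sg; split_ifs <;> norm_num
lemma abs_sg (a b : ZMod 2) : |sg a b| = 1 := by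
  unfold sg; split_ifs <;> norm_num

lemma chi_zero {n : ℕ} (y : Fin n → ZMod 2) : chi y 0 = 1 := by simp [chi, sg_zero_right]
lemma chi_add {n : ℕ} (y v w : Fin n → ZMod 2) : chi y (v + w) = chi y v * chi y w := by
  simp [chi, sg_add, Finset.prod_mul_distrib]
lemma chi_sum {n l : ℕ} (y : Fin n → ZMod 2) (w : Fin l → Fin n → ZMod 2) :
    chi y (∑ i, w i) = ∏ i, chi y (w i) := by
  have : ∀ s : Finset (Fin l), chi y (∑ i ∈ s, w i) = ∏ i ∈ s, chi y (w i) := by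
    intro s
    induction s using Finset.induction_on with
    | empty => simpa using chi_zero y
    | insert a s ha ih => rw [sum_insert ha, prod_insert ha, chi_add, ih]
  exact this univ
lemma abs_chi {n : ℕ} (y v : Fin n → ZMod 2) : |chi y v| = 1 := by
  simp [chi, Finset.abs_prod, abs_sg]

lemma chi_orth {n : ℕ} (v : Fin n → ZMod 2) :
    ∑ y, chi y v = if v = 0 then (2 : ℝ) ^ n else 0 := by
  have h := Finset.prod_univ_sum (fun _ : Fin n => (univ : Finset (ZMod 2)))
    (fun i a => sg a (v i))
  rw [Fintype.piFinset_univ] at h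
  unfold chi
  rw [← h]
  split_ifs with hv
  · subst hv
    simp [sg_zero_right]
  · obtain ⟨i, hi⟩ := Function.ne_iff.mp hv
    have hi1 : v i = 1 := (zmod2_cases (v i)).resolve_left hi
    apply Finset.prod_eq_zero (mem_univ i)
    rw [univ_zmod2, hi1, sum_pair (by decide), sg_zero_left, sg_one_one]
    norm_num

lemma count_eq (n t l : ℕ) :
    ((univ.filter (fun w : Fin l → (Fin n → ZMod 2) =>
            (∀ i, hammingNorm (w i) = t) ∧ (∑ i, w i) = 0)).card : ℝ) * 2 ^ n
      = ∑ y : Fin n → ZMod 2, EE y t ^ l := by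
  have h1 : ∀ y : Fin n → ZMod 2, EE y t ^ l
      = ∑ w ∈ Fintype.piFinset (fun _ : Fin l => SS n t), chi y (∑ i, w i) := by
    intro y
    have h := Finset.prod_univ_sum (fun _ : Fin l => SS n t) (fun _ v => chi y v)
    simp only [prod_const, card_univ, Fintype.card_fin] at h
    simp only [chi_sum]
    exact h
  simp only [h1]
  rw [sum_comm]
  simp only [chi_orth]
  rw [← Finset.sum_filter, sum_const, nsmul_eq_mul]
  congr 3
  ext w
  simp [SS, Fintype.mem_piFinset]

open Polynomial in
lemma gen_fun {n : ℕ} (y : Fin n → ZMod 2) (j : ℕ) :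
    (∏ i, (1 + Polynomial.C (sg (y i) 1) * X)).coeff j = EE y j := by
  have h := Finset.prod_univ_sum (fun _ : Fin n => (univ : Finset (ZMod 2)))
    (fun i a => Polynomial.C (sg (y i) a) * X ^ (if a = 0 then 0 else 1))
  rw [Fintype.piFinset_univ] at h
  have h2 : ∀ i, ∑ a : ZMod 2, Polynomial.C (sg (y i) a) * X ^ (if a = 0 then 0 else 1)
      = 1 + Polynomial.C (sg (y i) 1) * X := by
    intro i
    rw [univ_zmod2, sum_pair (by decide), sg_zero_right]
    simp
  simp only [h2] at h
  rw [h, Polynomial.finsetSum_coeff, EE, SS, Finset.sum_filter]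
  apply Finset.sum_congr rfl
  intro v _
  rw [Finset.prod_mul_distrib, Finset.prod_pow_eq_pow_sum]
  have h3 : ∑ i, (if v i = 0 then 0 else 1) = hammingNorm v := by
    rw [hammingNorm, Finset.card_filter]
    apply Finset.sum_congr rfl
    intro i _
    by_cases hh : v i = 0 <;> simp [hh]
  rw [h3, ← map_prod, Polynomial.coeff_C_mul_X_pow]
  simp only [chi, eq_comm]

lemma sg_wt (a : ZMod 2) : sg a 1 = 1 - 2 * (if a ≠ 0 then 1 else 0) := by
  rcases zmod2_cases a with rfl | rfl
  · simp [sg]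
  · simp [sg]; norm_num

lemma sum_sg {n : ℕ} (y : Fin n → ZMod 2) :
    ∑ i, sg (y i) 1 = (n : ℝ) - 2 * hammingNorm y := by
  simp only [sg_wt, sum_sub_distrib, ← mul_sum, hammingNorm, Finset.card_filter]
  simp

open Polynomial in
lemma gen_rec {n : ℕ} (y : Fin n → ZMod 2) :
    (1 - X ^ 2) * derivative (∏ i, (1 + Polynomial.C (sg (y i) 1) * X))
      = (Polynomial.C ((n : ℝ) - 2 * hammingNorm y) - Polynomial.C (n : ℝ) * X) * ∏ i, (1 + Polynomial.C (sg (y i) 1) * X) := by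
  have key : ∀ s : Finset (Fin n),
      (1 - X ^ 2) * derivative (∏ i ∈ s, (1 + Polynomial.C (sg (y i) 1) * X))
      = (∑ i ∈ s, (Polynomial.C (sg (y i) 1) - X)) * ∏ i ∈ s, (1 + Polynomial.C (sg (y i) 1) * X) := by
    intro s
    induction s using Finset.induction_on with
    | empty => simp
    | insert a s ha ih =>
      rw [sum_insert ha, prod_insert ha, derivative_mul]
      have h1 : (Polynomial.C (sg (y a) 1) * Polynomial.C (sg (y a) 1) : ℝ[X]) = 1 := by
        rw [← Polynomial.C_mul, sg_sq, Polynomial.C_1]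
      simp only [derivative_add, derivative_one, derivative_C_mul, derivative_X, zero_add, mul_one]
      linear_combination (1 + Polynomial.C (sg (y a) 1) * X) * ih -
        X * (∏ i ∈ s, (1 + Polynomial.C (sg (y i) 1) * X)) * h1
  rw [key univ, Finset.sum_sub_distrib, ← map_sum, sum_sg]
  simp

lemma EE_zero {n : ℕ} (y : Fin n → ZMod 2) : EE y 0 = 1 := by
  rw [← gen_fun, Polynomial.coeff_zero_prod]; simp

lemma EE_one {n : ℕ} (y : Fin n → ZMod 2) : EE y 1 = (n : ℝ) - 2 * hammingNorm y := by
  have h := congrArg (fun p => Polynomial.coeff p 0) (gen_rec y)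
  simp only [Polynomial.mul_coeff_zero, Polynomial.coeff_sub, Polynomial.coeff_derivative,
    gen_fun, EE_zero] at h
  simpa using h

lemma EE_rec {n : ℕ} (y : Fin n → ZMod 2) (j : ℕ) :
    ((j : ℝ) + 2) * EE y (j + 2) = ((n : ℝ) - 2 * hammingNorm y) * EE y (j + 1)
      - ((n : ℝ) - j) * EE y j := by
  have h := congrArg (fun p => Polynomial.coeff p (j + 1)) (gen_rec y)
  have hx : ∀ p : Polynomial ℝ, (Polynomial.X ^ 2 * Polynomial.derivative p).coeff (j + 1)
      = p.coeff j * j := by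
    intro p
    rw [pow_two, mul_assoc, Polynomial.coeff_X_mul]
    cases j with
    | zero => simp
    | succ j => rw [Polynomial.coeff_X_mul, Polynomial.coeff_derivative]; push_cast; ring
  simp only [sub_mul, one_mul, Polynomial.coeff_sub, hx, mul_assoc, Polynomial.coeff_C_mul,
    Polynomial.coeff_X_mul, Polynomial.coeff_derivative, gen_fun] at h
  push_cast at h
  linarith

lemma card_SS (n j : ℕ) : ((SS n j).card : ℝ) = n.choose j := by
  have h := gen_fun (0 : Fin n → ZMod 2) j
  simp only [Pi.zero_apply, sg_zero_left, map_one, one_mul, prod_const, card_univ,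
    Fintype.card_fin, Polynomial.coeff_one_add_X_pow] at h
  rw [h, EE]
  simp [chi, sg_zero_left]

lemma abs_EE_le {n : ℕ} (y : Fin n → ZMod 2) (j : ℕ) : |EE y j| ≤ n.choose j := by
  rw [← card_SS]
  refine (Finset.abs_sum_le_sum_abs _ _).trans ?_
  simp [abs_chi]

lemma EE_bound {n t : ℕ} (y : Fin n → ZMod 2) (b : ℝ) (hb : 0 < b) (htn : t ≤ n)
    (h : |(n : ℝ) - 2 * hammingNorm y| * b + t ≤ ((n : ℝ) - t) * b ^ 2) (j : ℕ) (hj : j ≤ t) :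
    |EE y j| ≤ n.choose j * b ^ j := by
  set m : ℝ := (n : ℝ) - 2 * hammingNorm y with hm
  have htn' : (t : ℝ) ≤ n := by exact_mod_cast htn
  induction j using Nat.strong_induction_on with
  | _ j ih =>
    match j with
    | 0 => simp [EE_zero]
    | 1 =>
      have ht1 : (1 : ℝ) ≤ t := by exact_mod_cast hj
      rw [EE_one, ← hm]
      simp only [Nat.choose_one_right, pow_one]
      have : |m| * b ≤ (n * b) * b := by nlinarith [sq_nonneg b]
      exact le_of_mul_le_mul_right this hb
    | j + 2 =>
      have i1 := ih (j + 1) (by omega) (by omega)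
      have i0 := ih j (by omega) (by omega)
      have hjt : (j : ℝ) + 2 ≤ t := by exact_mod_cast hj
      have c1 : (n.choose (j + 2) : ℝ) * (j + 2) = n.choose (j + 1) * ((n : ℝ) - (j + 1)) := by
        have := Nat.choose_succ_right_eq n (j + 1)
        have h2 : ((n - (j + 1) : ℕ) : ℝ) = (n : ℝ) - (j + 1) := by
          rw [Nat.cast_sub (by omega)]; push_cast; ring
        rw [← h2]; exact_mod_cast this
      have c0 : (n.choose (j + 1) : ℝ) * (j + 1) = n.choose j * ((n : ℝ) - j) := by
        have := Nat.choose_succ_right_eq n j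
        have h2 : ((n - j : ℕ) : ℝ) = (n : ℝ) - j := by
          rw [Nat.cast_sub (by omega)]
        rw [← h2]; exact_mod_cast this
      have hr := EE_rec y j
      rw [← hm] at hr
      have hnj : 0 ≤ (n : ℝ) - j := by linarith
      have a1 : ((j : ℝ) + 2) * |EE y (j + 2)| ≤ |m| * |EE y (j + 1)| + ((n : ℝ) - j) * |EE y j| := by
        have : ((j : ℝ) + 2) * |EE y (j + 2)| = |((j : ℝ) + 2) * EE y (j + 2)| := by
          rw [abs_mul, abs_of_nonneg (by positivity : (0 : ℝ) ≤ (j : ℝ) + 2)]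
        rw [this, hr]
        refine (abs_sub _ _).trans ?_
        rw [abs_mul, abs_mul, abs_of_nonneg hnj]
      have a2 : |m| * |EE y (j + 1)| ≤ |m| * (n.choose (j + 1) * b ^ (j + 1)) :=
        mul_le_mul_of_nonneg_left i1 (abs_nonneg _)
      have a3 : ((n : ℝ) - j) * |EE y j| ≤ ((n : ℝ) - j) * (n.choose j * b ^ j) :=
        mul_le_mul_of_nonneg_left i0 hnj
      have a4 : |m| * b + (j + 1) ≤ ((n : ℝ) - (j + 1)) * b ^ 2 := by
        nlinarith [sq_nonneg b]
      have a5 := mul_le_mul_of_nonneg_left a4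
        (by positivity : (0 : ℝ) ≤ n.choose (j + 1) * b ^ j)
      have hj2 : (0 : ℝ) < (j : ℝ) + 2 := by positivity
      refine le_of_mul_le_mul_left ?_ hj2
      calc ((j : ℝ) + 2) * |EE y (j + 2)| ≤ _ := a1
        _ ≤ |m| * (n.choose (j + 1) * b ^ (j + 1)) + ((n : ℝ) - j) * (n.choose j * b ^ j) :=
          add_le_add a2 a3
        _ = (n.choose (j + 1) * b ^ j) * (|m| * b + (j + 1)) := by
          linear_combination (-(b ^ j)) * c0
        _ ≤ _ := a5
        _ = _ := by
          push_cast
          linear_combination (-(b ^ (j + 2))) * c1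

lemma sum_eq (n t r : ℕ) (htn : t ≤ n) :
    ∑ l ∈ Finset.Icc 1 r, (r.choose l : ℝ) *
        (((univ.filter (fun w : Fin l → (Fin n → ZMod 2) =>
            (∀ i, hammingNorm (w i) = t) ∧ (∑ i, w i) = 0)).card : ℝ) /
          (((univ.filter (fun v : Fin n → ZMod 2 => hammingNorm v = t)).card : ℝ)) ^ l)
    = (∑ y : Fin n → ZMod 2, ((1 + EE y t / n.choose t) ^ r - 1)) / 2 ^ n := by
  have hS : ((univ.filter (fun v : Fin n → ZMod 2 => hammingNorm v = t)).card : ℝ) = n.choose t :=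
    card_SS n t
  have h2 : (2 : ℝ) ^ n ≠ 0 := by positivity
  rw [eq_div_iff h2, sum_mul]
  have h3 : ∀ y : Fin n → ZMod 2, (1 + EE y t / n.choose t) ^ r - 1
      = ∑ l ∈ Finset.Icc 1 r, (r.choose l : ℝ) * (EE y t / n.choose t) ^ l := by
    intro y
    rw [add_comm, add_pow, Finset.range_eq_Ico, Finset.sum_eq_sum_Ico_succ_bot (by omega)]
    simp only [one_pow, mul_one, pow_zero, Nat.choose_zero_right, Nat.cast_one, add_sub_cancel_left]
    apply Finset.sum_congr
    · ext; simp
    · intros; ring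
  simp only [h3]
  rw [sum_comm]
  apply Finset.sum_congr rfl
  intro l _
  rw [hS, ← mul_sum]
  simp only [div_pow]
  rw [← Finset.sum_div, ← count_eq]
  ring

lemma sum_wt (n : ℕ) (g : ℕ → ℝ) :
    ∑ y : Fin n → ZMod 2, g (hammingNorm y) = ∑ k ∈ range (n + 1), (n.choose k : ℝ) * g k := by
  rw [← Finset.sum_fiberwise_of_maps_to (s := univ) (t := range (n + 1)) (g := fun y : Fin n → ZMod 2 => hammingNorm y)]
  · apply Finset.sum_congr rfl
    intro k _
    rw [← card_SS, SS, ← nsmul_eq_mul, ← sum_const]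
    apply Finset.sum_congr rfl
    intro y hy
    rw [(mem_filter.mp hy).2]
  · intro y _
    have := hammingNorm_le_card_fintype (x := y)
    simp at this ⊢
    omega

lemma choose_exp (n k : ℕ) (hn : 0 < n) (hk : k ≤ n) :
    (n.choose k : ℝ) * Real.exp (((n : ℝ) - 2 * k) ^ 2 / (2 * n)) ≤ 2 ^ n := by
  have hn' : (0 : ℝ) < n := by exact_mod_cast hn
  set lam : ℝ := ((n : ℝ) - 2 * k) / n with hlam
  have h1 : (n.choose k : ℝ) * Real.exp (lam * ((n : ℝ) - 2 * k))
      ≤ (Real.exp (-lam) + Real.exp lam) ^ n := by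
    rw [add_pow]
    have := Finset.single_le_sum (s := range (n + 1))
      (f := fun m => Real.exp (-lam) ^ m * Real.exp lam ^ (n - m) * (n.choose m : ℝ))
      (fun i _ => by positivity) (mem_range.mpr (Nat.lt_succ_of_le hk))
    refine le_trans (le_of_eq ?_) this
    rw [← Real.exp_nat_mul, ← Real.exp_nat_mul, ← Real.exp_add, mul_comm, Nat.cast_sub hk]
    congr 2
    ring
  have h2 : (Real.exp (-lam) + Real.exp lam) ^ n ≤ 2 ^ n * Real.exp (n * (lam ^ 2 / 2)) := by
    have : Real.exp (-lam) + Real.exp lam = 2 * Real.cosh lam := by rw [Real.cosh_eq]; ring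
    rw [this, mul_pow, Real.exp_nat_mul]
    gcongr
    exact Real.cosh_le_exp_half_sq lam
  have h3 := h1.trans h2
  have e1 : lam * ((n : ℝ) - 2 * k) = ((n : ℝ) - 2 * k) ^ 2 / (2 * n) + n * (lam ^ 2 / 2) := by
    rw [hlam]; field_simp; ring
  rw [e1, Real.exp_add, ← mul_assoc] at h3
  exact le_of_mul_le_mul_right h3 (Real.exp_pos _)

lemma choose_small (n k : ℕ) (hk : k ≤ n) (hkn : (k : ℝ) ≤ 0.0001 * n) :
    (n.choose k : ℝ) ≤ (2 : ℝ) ^ (0.005 * (n : ℝ)) := by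
  have h1 : (n.choose k : ℝ) * (1 / 1000) ^ k ≤ (1 / 1000 + 1) ^ n := by
    rw [add_pow]
    have := Finset.single_le_sum (s := range (n + 1))
      (f := fun m => (1 / 1000 : ℝ) ^ m * 1 ^ (n - m) * (n.choose m : ℝ))
      (fun i _ => by positivity) (mem_range.mpr (Nat.lt_succ_of_le hk))
    refine le_trans (le_of_eq ?_) this
    simp only [one_pow]; ring
  have h2 : (1 / 1000 + 1 : ℝ) ^ n ≤ Real.exp (n * (1 / 1000)) := by
    rw [Real.exp_nat_mul]
    gcongr
    exact Real.add_one_le_exp _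
  have h3 : (1000 : ℝ) ^ k ≤ Real.exp (k * (10 * Real.log 2)) := by
    rw [Real.exp_nat_mul]
    gcongr
    have : Real.exp (10 * Real.log 2) = 2 ^ 10 := by
      rw [show (10 : ℝ) * Real.log 2 = ((10 : ℕ) : ℝ) * Real.log 2 by norm_num,
        Real.exp_nat_mul, Real.exp_log (by norm_num)]
    rw [this]; norm_num
  have h4 : (n.choose k : ℝ) = (n.choose k : ℝ) * (1 / 1000) ^ k * 1000 ^ k := by
    rw [mul_assoc, ← mul_pow]; norm_num
  rw [h4, Real.rpow_def_of_pos (by norm_num)]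
  calc _ ≤ Real.exp (n * (1 / 1000)) * Real.exp (k * (10 * Real.log 2)) := by
        gcongr; exact h1.trans h2
    _ = Real.exp (n * (1 / 1000) + k * (10 * Real.log 2)) := by rw [Real.exp_add]
    _ ≤ _ := by
        apply Real.exp_le_exp.mpr
        have hl := Real.log_two_gt_d9
        have hn : (0 : ℝ) ≤ n := by positivity
        have : (k : ℝ) * (10 * Real.log 2) ≤ 0.0001 * n * (10 * Real.log 2) := by gcongr
        nlinarith

noncomputable def DD (n t : ℕ) : ℝ := Real.sqrt ((64 * t / n) ^ t) * Real.exp (t / 4)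

lemma DD_nonneg (n t : ℕ) : 0 ≤ DD n t := by unfold DD; positivity

noncomputable def gg (n t r k : ℕ) : ℝ :=
  if (k : ℝ) ≤ 0.0001 * n ∨ ((n - k : ℕ) : ℝ) ≤ 0.0001 * n then 2 ^ r
  else n * DD n t * Real.exp (((n : ℝ) - 2 * k) ^ 2 / (4 * n))

lemma choose_gg (n t r k : ℕ) (hn : 0 < n) (hk : k ≤ n) (hr : (r : ℝ) ≤ 0.99 * n) :
    (n.choose k : ℝ) * gg n t r k ≤ 2 ^ n * ((2 : ℝ) ^ (-(0.005 * (n : ℝ))) + n * DD n t) := by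
  have hn' : (0 : ℝ) < n := by exact_mod_cast hn
  have hD := DD_nonneg n t
  unfold gg
  split_ifs with h
  · have hc : (n.choose k : ℝ) ≤ (2 : ℝ) ^ (0.005 * (n : ℝ)) := by
      rcases h with h | h
      · exact choose_small n k hk h
      · rw [← Nat.choose_symm hk]
        exact choose_small n (n - k) (Nat.sub_le _ _) h
    have hr2 : (2 : ℝ) ^ r ≤ (2 : ℝ) ^ (0.99 * (n : ℝ)) := by
      rw [← Real.rpow_natCast]
      exact Real.rpow_le_rpow_of_exponent_le (by norm_num) hr
    calc (n.choose k : ℝ) * 2 ^ r ≤ (2 : ℝ) ^ (0.005 * (n : ℝ)) * (2 : ℝ) ^ (0.99 * (n : ℝ)) := by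
          gcongr
      _ = 2 ^ n * (2 : ℝ) ^ (-(0.005 * (n : ℝ))) := by
          rw [← Real.rpow_natCast, ← Real.rpow_add (by norm_num), ← Real.rpow_add (by norm_num)]
          congr 1; ring
      _ ≤ _ := by
          gcongr
          have : 0 ≤ n * DD n t := by positivity
          linarith
  · have h1 := choose_exp n k hn hk
    have h2 : Real.exp (((n : ℝ) - 2 * k) ^ 2 / (4 * n)) ≤ Real.exp (((n : ℝ) - 2 * k) ^ 2 / (2 * n)) := by
      apply Real.exp_le_exp.mpr
      gcongr
      norm_num
    calc (n.choose k : ℝ) * (n * DD n t * Real.exp (((n : ℝ) - 2 * k) ^ 2 / (4 * n)))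
        ≤ (n.choose k : ℝ) * (n * DD n t * Real.exp (((n : ℝ) - 2 * k) ^ 2 / (2 * n))) := by gcongr
      _ = (n * DD n t) * ((n.choose k : ℝ) * Real.exp (((n : ℝ) - 2 * k) ^ 2 / (2 * n))) := by ring
      _ ≤ (n * DD n t) * 2 ^ n := by gcongr
      _ ≤ _ := by
          have : (0 : ℝ) ≤ 2 ^ n * (2 : ℝ) ^ (-(0.005 * (n : ℝ))) := by positivity
          linarith

set_option maxHeartbeats 2000000 in
lemma term_le {n t r : ℕ} (y : Fin n → ZMod 2) (hn : 0 < n) (ht2 : 2 ≤ t)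
    (htn : (t : ℝ) ≤ (1 / 10 ^ 10) * n) (hq : 64 * (0.9999 : ℝ) ^ (t - 2) ≤ 1)
    (hr : (r : ℝ) ≤ 0.99 * n) :
    (1 + EE y t / n.choose t) ^ r - 1 ≤ gg n t r (hammingNorm y) := by
  have hn' : (0 : ℝ) < n := by exact_mod_cast hn
  have ht' : (2 : ℝ) ≤ t := by exact_mod_cast ht2
  have htn0 : (t : ℝ) ≤ n := by linarith
  have htn1 : t ≤ n := by exact_mod_cast htn0
  have hch : (0 : ℝ) < n.choose t := by exact_mod_cast Nat.choose_pos htn1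
  set K := EE y t / n.choose t with hK
  have hK1 : |K| ≤ 1 := by
    rw [hK, abs_div, abs_of_pos hch, div_le_one hch]; exact abs_EE_le y t
  have hK2 := abs_le.mp hK1
  have hkn : hammingNorm y ≤ n := by
    simpa using hammingNorm_le_card_fintype (x := y)
  unfold gg
  split_ifs with h
  · have : (1 + K) ^ r ≤ 2 ^ r := by
      apply pow_le_pow_left₀ <;> linarith
    linarith
  · push Not at h
    obtain ⟨hl, hu⟩ := h
    rw [Nat.cast_sub hkn] at hu
    set m : ℝ := (n : ℝ) - 2 * hammingNorm y with hm
    have hmabs : |m| ≤ 0.9998 * n := by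
      rw [abs_le]; constructor <;> linarith
    have hd : 0 < (n : ℝ) - t := by linarith
    set s := Real.sqrt (t / ((n : ℝ) - t)) with hs
    have hs2 : s ^ 2 = t / ((n : ℝ) - t) := Real.sq_sqrt (by positivity)
    have hs0 : 0 < s := Real.sqrt_pos.mpr (by positivity)
    have hss : s ^ 2 * ((n : ℝ) - t) = t := by rw [hs2]; field_simp
    set a := |m| / ((n : ℝ) - t) with ha
    have ha0 : 0 ≤ a := by positivity
    have haa : a * ((n : ℝ) - t) = |m| := by rw [ha]; field_simp
    have hb0 : 0 < a + s := by positivity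
    have hcond : |m| * (a + s) + t ≤ ((n : ℝ) - t) * (a + s) ^ 2 := by
      rw [← haa]
      have : 0 ≤ a * s * ((n : ℝ) - t) := by positivity
      nlinarith
    have hE := EE_bound y (a + s) hb0 htn1 hcond t le_rfl
    have hKb : |K| ≤ (a + s) ^ t := by
      rw [hK, abs_div, abs_of_pos hch, div_le_iff₀ hch, mul_comm]; exact hE
    have ha1 : a ≤ 0.99981 := by
      rw [ha, div_le_iff₀ hd]; linarith
    have hs1 : s ≤ 0.00002 := by
      rw [hs]
      apply Real.sqrt_le_iff.mpr
      constructor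
      · norm_num
      · rw [div_le_iff₀ hd]; linarith
    have hb1 : a + s ≤ 0.9999 := by linarith
    set v : ℝ := (m ^ 2 / n + t) / 8 with hv
    have hv0 : 0 ≤ v := by positivity
    have hbv : (a + s) ^ 2 ≤ 64 * v / n := by
      have h1 : (a + s) ^ 2 ≤ 2 * a ^ 2 + 2 * s ^ 2 := by nlinarith [sq_nonneg (a - s)]
      have h2 : a ^ 2 ≤ 4 * m ^ 2 / n ^ 2 := by
        rw [ha, div_pow, sq_abs, div_le_div_iff₀ (by positivity) (by positivity)]
        have : (n : ℝ) ^ 2 ≤ 4 * ((n : ℝ) - t) ^ 2 := by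
          have hh : (n : ℝ) ≤ 2 * ((n : ℝ) - t) := by linarith
          linarith [mul_self_le_mul_self hn'.le hh]
        linarith [mul_le_mul_of_nonneg_left this (sq_nonneg m)]
      have h3 : s ^ 2 ≤ 2 * t / n := by
        rw [hs2, div_le_div_iff₀ hd hn']
        have hh : (n : ℝ) ≤ 2 * ((n : ℝ) - t) := by linarith
        have := mul_le_mul_of_nonneg_left hh (by positivity : (0 : ℝ) ≤ t)
        linarith
      have h4 : 64 * v / n = 8 * m ^ 2 / n ^ 2 + 8 * t / n := by rw [hv]; field_simp; ring
      have h5 : (4 : ℝ) * t / n ≤ 8 * t / n := by gcongr; norm_num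
      have h6 : 2 * (4 * m ^ 2 / (n : ℝ) ^ 2) = 8 * m ^ 2 / n ^ 2 := by ring
      have h7 : 2 * (2 * (t : ℝ) / n) = 4 * t / n := by ring
      linarith
    have hrn : (r : ℝ) ≤ n := by linarith
    have hx1 : r * |K| ≤ v := by
      have h1 : (a + s) ^ t = (a + s) ^ 2 * (a + s) ^ (t - 2) := by
        rw [← pow_add]; congr 1; omega
      have h2 : (a + s) ^ (t - 2) ≤ 0.9999 ^ (t - 2) := pow_le_pow_left₀ hb0.le hb1 _
      calc r * |K| ≤ n * ((64 * v / n) * 0.9999 ^ (t - 2)) := by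
            gcongr
            rw [h1] at hKb
            refine hKb.trans ?_
            gcongr
        _ = v * (64 * 0.9999 ^ (t - 2)) := by field_simp
        _ ≤ v * 1 := by gcongr
        _ = v := mul_one v
    have hx2 : |K| ≤ Real.sqrt ((64 * t / n) ^ t) * Real.exp v := by
      refine hKb.trans ?_
      have h1 : v ^ t ≤ (t : ℝ) ^ t * Real.exp v := by
        have h2 := Real.pow_div_factorial_le_exp v hv0 t
        rw [div_le_iff₀ (by positivity)] at h2
        have h3 : ((t.factorial : ℕ) : ℝ) ≤ (t : ℝ) ^ t := by exact_mod_cast Nat.factorial_le_pow t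
        calc v ^ t ≤ Real.exp v * t.factorial := h2
          _ ≤ Real.exp v * (t : ℝ) ^ t := by gcongr
          _ = _ := mul_comm _ _
      apply (pow_le_pow_iff_left₀ (by positivity) (by positivity) two_ne_zero).mp
      rw [mul_pow, Real.sq_sqrt (by positivity)]
      calc ((a + s) ^ t) ^ 2 = ((a + s) ^ 2) ^ t := by rw [← pow_mul, ← pow_mul, mul_comm]
        _ ≤ (64 * v / n) ^ t := by gcongr
        _ = (64 / n) ^ t * v ^ t := by rw [← mul_pow]; congr 1; ring
        _ ≤ (64 / n) ^ t * ((t : ℝ) ^ t * Real.exp v) := by gcongr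
        _ = (64 * t / n) ^ t * Real.exp v := by
            rw [← mul_assoc, ← mul_pow]; congr 2; ring
        _ ≤ (64 * t / n) ^ t * (Real.exp v) ^ 2 := by
            gcongr
            have := Real.one_le_exp hv0
            nlinarith
    set x := r * |K| with hx
    have hx0 : 0 ≤ x := by positivity
    have hpow : (1 + K) ^ r ≤ Real.exp x := by
      rw [hx, Real.exp_nat_mul]
      apply pow_le_pow_left₀ (by linarith)
      have := Real.add_one_le_exp |K|
      linarith [le_abs_self K]
    have hexp : Real.exp x - 1 ≤ x * Real.exp x := by
      have h1 := Real.add_one_le_exp (-x)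
      have h2 : Real.exp (-x) * Real.exp x = 1 := by rw [← Real.exp_add]; simp
      nlinarith [Real.exp_pos x]
    have hfin : x * Real.exp x ≤ n * DD n t * Real.exp (m ^ 2 / (4 * n)) := by
      calc x * Real.exp x ≤ (n * (Real.sqrt ((64 * t / n) ^ t) * Real.exp v)) * Real.exp v := by
            gcongr
            exact mul_le_mul hrn hx2 (abs_nonneg _) hn'.le
        _ = n * (Real.sqrt ((64 * t / n) ^ t) * Real.exp (v + v)) := by rw [Real.exp_add]; ring
        _ = n * DD n t * Real.exp (m ^ 2 / (4 * n)) := by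
            have : v + v = t / 4 + m ^ 2 / (4 * n) := by rw [hv]; field_simp; ring
            rw [this, Real.exp_add, DD]; ring
    linarith

lemma total_le {n t r : ℕ} (hn : 0 < n) (ht2 : 2 ≤ t)
    (htn : (t : ℝ) ≤ (1 / 10 ^ 10) * n) (hq : 64 * (0.9999 : ℝ) ^ (t - 2) ≤ 1)
    (hr : (r : ℝ) ≤ 0.99 * n) :
    (∑ y : Fin n → ZMod 2, ((1 + EE y t / n.choose t) ^ r - 1)) / 2 ^ n
      ≤ (n + 1) * ((2 : ℝ) ^ (-(0.005 * (n : ℝ))) + n * DD n t) := by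
  rw [div_le_iff₀ (by positivity)]
  calc _ ≤ ∑ y : Fin n → ZMod 2, gg n t r (hammingNorm y) :=
        Finset.sum_le_sum (fun y _ => term_le y hn ht2 htn hq hr)
    _ = ∑ k ∈ range (n + 1), (n.choose k : ℝ) * gg n t r k := sum_wt n _
    _ ≤ ∑ k ∈ range (n + 1), 2 ^ n * ((2 : ℝ) ^ (-(0.005 * (n : ℝ))) + n * DD n t) := by
        apply Finset.sum_le_sum
        intro k hk
        exact choose_gg n t r k hn (Nat.lt_succ_iff.mp (mem_range.mp hk)) hr
    _ = _ := by
        rw [sum_const, card_range, nsmul_eq_mul]; push_cast; ring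

lemma DD_le {n t : ℕ} (hn : 0 < n) (h : 64 * t * Real.exp 1 ≤ Real.sqrt n) :
    DD n t ≤ (n : ℝ) ^ (-((t : ℝ) / 4)) := by
  have hn' : (0 : ℝ) < n := by exact_mod_cast hn
  unfold DD
  apply (pow_le_pow_iff_left₀ (by positivity) (by positivity) two_ne_zero).mp
  rw [mul_pow, Real.sq_sqrt (by positivity)]
  have h1 : Real.exp ((t : ℝ) / 4) ^ 2 ≤ Real.exp 1 ^ t := by
    rw [← Real.exp_nat_mul, ← Real.exp_nat_mul]
    apply Real.exp_le_exp.mpr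
    have : (0 : ℝ) ≤ t := by positivity
    push_cast; linarith
  have h2 : ((n : ℝ) ^ (-((t : ℝ) / 4))) ^ 2 = ((n : ℝ) ^ (-(1 / 2) : ℝ)) ^ t := by
    rw [← Real.rpow_natCast, ← Real.rpow_natCast, ← Real.rpow_mul hn'.le, ← Real.rpow_mul hn'.le]
    congr 1; push_cast; ring
  rw [h2]
  calc _ ≤ (64 * (t : ℝ) / n) ^ t * Real.exp 1 ^ t := by gcongr
    _ = (64 * t * Real.exp 1 / n) ^ t := by rw [← mul_pow]; congr 1; ring
    _ ≤ _ := by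
      apply pow_le_pow_left₀ (by positivity)
      rw [div_le_iff₀ hn', Real.rpow_neg hn'.le, ← Real.sqrt_eq_rpow]
      refine h.trans (le_of_eq ?_)
      have := Real.mul_self_sqrt hn'.le
      have h0 : Real.sqrt n ≠ 0 := (Real.sqrt_pos.mpr hn').ne'
      field_simp
      linarith

lemma ev1 (A : ℝ) (hA : 0 < A) : ∀ᶠ n : ℕ in atTop, A * Real.logb 2 n ≤ Real.sqrt n := by
  have h := (isLittleO_log_rpow_atTop (show (0 : ℝ) < 1 / 2 by norm_num)).comp_tendsto
    tendsto_natCast_atTop_atTop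
  have hl : 0 < Real.log 2 := Real.log_pos (by norm_num)
  have h2 := h.bound (show 0 < Real.log 2 / A by positivity)
  filter_upwards [h2] with n hn
  simp only [Function.comp, Real.norm_eq_abs] at hn
  rw [← Real.sqrt_eq_rpow, abs_of_nonneg (Real.sqrt_nonneg _)] at hn
  have h3 := (le_abs_self _).trans hn
  rw [Real.logb, ← mul_div_assoc, div_le_iff₀ hl]
  calc A * Real.log n ≤ A * (Real.log 2 / A * Real.sqrt n) := by gcongr
    _ = _ := by field_simp

lemma ev2 (C : ℝ) (hC : 0 < C) : ∀ᶠ n : ℕ in atTop,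
    C / 8 * Real.logb 2 n ^ 2 + Real.logb 2 n + 2 ≤ 0.005 * n := by
  have hl : 0 < Real.log 2 := Real.log_pos (by norm_num)
  have h := (Real.isLittleO_pow_log_id_atTop (n := 2)).comp_tendsto (tendsto_natCast_atTop_atTop (R := ℝ))
  have h2 := h.bound (show 0 < 0.002 / (C / 8) * Real.log 2 ^ 2 by positivity)
  filter_upwards [h2, ev1 1 one_pos, eventually_ge_atTop 1000000] with n hn h1 hbig
  have hbig' : (1000000 : ℝ) ≤ n := by exact_mod_cast hbig
  simp only [Function.comp, Real.norm_eq_abs, id, abs_pow, sq_abs, Nat.abs_cast] at hn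
  have h3 : C / 8 * Real.logb 2 n ^ 2 ≤ 0.002 * n := by
    rw [Real.logb, div_pow, ← mul_div_assoc, div_le_iff₀ (by positivity)]
    calc C / 8 * Real.log n ^ 2 ≤ C / 8 * (0.002 / (C / 8) * Real.log 2 ^ 2 * n) := by gcongr
      _ = _ := by field_simp
  have h4 : Real.sqrt n ≤ 0.001 * n := by
    apply Real.sqrt_le_iff.mpr
    constructor
    · positivity
    · nlinarith
  linarith

/-- Fix `C > 0` and `t : ℕ → ℕ` with `t n/√(log n) → ∞` and
`t n ≤ C·log n`.  Then there exist `c > 0` and `N₀` such that for all `n ≥ N₀` and all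
integers `1 ≤ r ≤ 0.99·n`:
`Σ_{ℓ=1}^{r} C(r,ℓ)·Pr[w₁ ⊕ ⋯ ⊕ w_ℓ = 0] ≤ 2^{−c·t(n)²}`, where `w₁, …, w_ℓ` are
independent uniform elements of the set of weight-`t n` vectors in `F₂ⁿ` (the probability
is written as a counting ratio). -/
theorem stmt_11 (C : ℝ) (hC : 0 < C) (t : ℕ → ℕ)
    (ht1 : Tendsto (fun n : ℕ => (t n : ℝ) / Real.sqrt (Real.logb 2 n)) atTop atTop)
    (ht2 : ∀ n : ℕ, (t n : ℝ) ≤ C * Real.logb 2 n) :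
    ∃ c : ℝ, 0 < c ∧ ∃ N₀ : ℕ, ∀ n ≥ N₀, ∀ r : ℕ, 1 ≤ r → (r : ℝ) ≤ 0.99 * n →
      ∑ l ∈ Finset.Icc 1 r, (r.choose l : ℝ) *
        (((univ.filter (fun w : Fin l → (Fin n → ZMod 2) =>
            (∀ i, hammingNorm (w i) = t n) ∧ (∑ i, w i) = 0)).card : ℝ) /
          (((univ.filter (fun v : Fin n → ZMod 2 => hammingNorm v = t n)).card : ℝ)) ^ l)
      ≤ (2 : ℝ) ^ (-(c * (t n : ℝ) ^ 2)) := by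
  refine ⟨1 / (8 * C), by positivity, ?_⟩
  obtain ⟨T, hT⟩ : ∃ T : ℕ, (0.9999 : ℝ) ^ T < 1 / 64 :=
    exists_pow_lt_of_lt_one (by norm_num) (by norm_num)
  have hev := ((ht1.eventually_ge_atTop ((T + 64 : ℕ) : ℝ)).and
    ((ev1 (64 * C * Real.exp 1) (by positivity)).and
    ((ev2 C hC).and (eventually_ge_atTop (10 ^ 20)))))
  obtain ⟨N, hN⟩ := eventually_atTop.mp hev
  refine ⟨N, fun n hn r _ hr => ?_⟩
  obtain ⟨h1, h2, h3, h4⟩ := hN n hn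
  have h4' : (10 ^ 20 : ℝ) ≤ n := by exact_mod_cast h4
  have hn0 : 0 < n := by omega
  have hn' : (0 : ℝ) < n := by exact_mod_cast hn0
  set L := Real.logb 2 n with hL
  have hnL : (2 : ℝ) ^ L = n := Real.rpow_logb (by norm_num) (by norm_num) hn'
  have hL1 : 1 ≤ L := by
    rw [hL, Real.le_logb_iff_rpow_le (by norm_num) hn']
    rw [Real.rpow_one]; linarith
  have hsL : 1 ≤ Real.sqrt L := Real.one_le_sqrt.mpr hL1
  have htT : ((T + 64 : ℕ) : ℝ) ≤ t n := by
    rw [le_div_iff₀ (by positivity)] at h1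
    have : (0 : ℝ) ≤ ((T + 64 : ℕ) : ℝ) := by positivity
    nlinarith
  have htT' : T + 64 ≤ t n := by exact_mod_cast htT
  have ht64 : (64 : ℝ) ≤ t n := by
    have : 64 ≤ t n := by omega
    exact_mod_cast this
  have hsq : 64 * (t n : ℝ) * Real.exp 1 ≤ Real.sqrt n := by
    refine le_trans ?_ h2
    have := mul_le_mul_of_nonneg_left (ht2 n) (by positivity : (0 : ℝ) ≤ 64 * Real.exp 1)
    linarith
  have htn : (t n : ℝ) ≤ (1 / 10 ^ 10) * n := by
    have he := Real.add_one_le_exp (1 : ℝ)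
    have h5 : (t n : ℝ) ≤ Real.sqrt n := by nlinarith
    have h6 : Real.sqrt n ≤ (1 / 10 ^ 10) * n := by
      apply Real.sqrt_le_iff.mpr
      constructor
      · positivity
      · nlinarith
    linarith
  have hq : 64 * (0.9999 : ℝ) ^ (t n - 2) ≤ 1 := by
    have : (0.9999 : ℝ) ^ (t n - 2) ≤ 0.9999 ^ T :=
      pow_le_pow_of_le_one (by norm_num) (by norm_num) (by omega)
    linarith
  have htn1 : t n ≤ n := by
    have : (t n : ℝ) ≤ n := by linarith
    exact_mod_cast this
  rw [sum_eq n (t n) r htn1]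
  refine (total_le hn0 (by omega) htn hq hr).trans ?_
  have hD := DD_le hn0 hsq
  have hc : 1 / (8 * C) * (t n : ℝ) ^ 2 ≤ t n * L / 8 := by
    rw [div_mul_eq_mul_div, div_le_iff₀ (by positivity)]
    have := mul_le_mul_of_nonneg_left (ht2 n) (by positivity : (0 : ℝ) ≤ t n)
    linarith
  have hc2 : t n * L / 8 ≤ C / 8 * L ^ 2 := by
    have := mul_le_mul_of_nonneg_right (ht2 n) (by positivity : (0 : ℝ) ≤ L)
    linarith
  have p1 : ((n : ℝ) + 1) * (2 : ℝ) ^ (-(0.005 * (n : ℝ))) ≤ 1 / 2 * (2 : ℝ) ^ (-(1 / (8 * C) * (t n : ℝ) ^ 2)) := by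
    calc ((n : ℝ) + 1) * (2 : ℝ) ^ (-(0.005 * (n : ℝ)))
        ≤ (2 : ℝ) ^ (L + 1) * (2 : ℝ) ^ (-(0.005 * (n : ℝ))) := by
          gcongr
          rw [Real.rpow_add (by norm_num), hnL, Real.rpow_one]; linarith
      _ = (2 : ℝ) ^ (L + 1 + -(0.005 * (n : ℝ))) := (Real.rpow_add (by norm_num) _ _).symm
      _ ≤ (2 : ℝ) ^ (-1 + -(1 / (8 * C) * (t n : ℝ) ^ 2)) := by
          apply Real.rpow_le_rpow_of_exponent_le (by norm_num)
          linarith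
      _ = _ := by
          rw [Real.rpow_add (by norm_num), Real.rpow_neg_one]; norm_num
  have p2 : ((n : ℝ) + 1) * (n * DD n (t n)) ≤ 1 / 2 * (2 : ℝ) ^ (-(1 / (8 * C) * (t n : ℝ) ^ 2)) := by
    calc ((n : ℝ) + 1) * (n * DD n (t n)) = ((n : ℝ) + 1) * n * DD n (t n) := by ring
      _ ≤ (1 / 2 * (n : ℝ) ^ (4 : ℝ)) * (n : ℝ) ^ (-((t n : ℝ) / 4)) := by
          apply mul_le_mul _ hD (DD_nonneg _ _) (by positivity)
          have : (n : ℝ) ^ (4 : ℝ) = (n : ℝ) ^ (4 : ℕ) := by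
            rw [← Real.rpow_natCast]; norm_num
          rw [this]
          have h10 : (10 : ℝ) ≤ n := by linarith
          have h11 : (100 : ℝ) ≤ n ^ 2 := by nlinarith
          nlinarith
      _ = 1 / 2 * (n : ℝ) ^ (4 + -((t n : ℝ) / 4)) := by rw [Real.rpow_add hn']; ring
      _ ≤ 1 / 2 * (n : ℝ) ^ (-((t n : ℝ) / 8)) := by
          gcongr
          · linarith
          · linarith
      _ = 1 / 2 * (2 : ℝ) ^ (-(t n * L / 8)) := by
          rw [← hnL, ← Real.rpow_mul (by norm_num)]
          congr 2; ring
      _ ≤ _ := by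
          gcongr
          norm_num
  rw [mul_add]
  linarith
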